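/- Let (X,b,c,m) be a weighted graph, E a Hermitian vector bundle over X with unitary connection Φ, and W a bundle endomorphism with ⟨W(x)v,v⟩_x ≥ c(x)|v|²_x for all x ∈ X and v ∈ E_x. Let u be in the domain of Q^(N)_{Φ,b,W} and v in the domain of Q^(N)_{b,c} with 0 ≤ v(x) ≤ |u(x)|_x for all x ∈ X. Then the section v·sgn u (defined by x ↦ v(x)u(x)/|u(x)|_x if u(x) ≠ 0 and 0 otherwise) lies in the domain of Q^(N)_{Φ,b,W} and satisfies Q̃_{Φ,b,W}(v·sgn u) ≤ Q^(N)_{b,c}(v) + Q^(N)_{Φ,b,W}(u). -/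

import Mathlib

open scoped ENNReal ComplexInnerProductSpace Classical

noncomputable section

/-- `u` is an `ℓ²`-section with respect to the vertex measure `m`. -/
def MemL2Sec {X : Type*} {E : X → Type*} [∀ x, NormedAddCommGroup (E x)]
    (m : X → ℝ) (u : ∀ x, E x) : Prop :=
  Summable fun x => ‖u x‖ ^ 2 * m x

/-- The magnetic Schrödinger energy `Q̃_{Φ,b,W}(u) ∈ [0,∞]` of a section `u`. -/
def magEnergy {X : Type*} {E : X → Type*} [∀ x, NormedAddCommGroup (E x)]
    [∀ x, InnerProductSpace ℂ (E x)]
    (b : X → X → ℝ) (Φ : ∀ x y, E y ≃ₗᵢ[ℂ] E x) (W : ∀ x, E x →ₗ[ℂ] E x)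
    (u : ∀ x, E x) : ℝ≥0∞ :=
  1 / 2 * ∑' p : X × X, ENNReal.ofReal (b p.1 p.2 * ‖u p.1 - Φ p.1 p.2 (u p.2)‖ ^ 2)
    + ∑' x, ENNReal.ofReal (⟪W x (u x), u x⟫).re

/-- The scalar Schrödinger energy `Q̃_{b,c}(f) ∈ [0,∞]` of a function `f : X → ℂ`. -/
def scalEnergy {X : Type*} (b : X → X → ℝ) (c : X → ℝ) (f : X → ℂ) : ℝ≥0∞ :=
  1 / 2 * ∑' p : X × X, ENNReal.ofReal (b p.1 p.2 * ‖f p.1 - f p.2‖ ^ 2)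
    + ∑' x, ENNReal.ofReal (c x * ‖f x‖ ^ 2)

/-- Membership in the domain of the Neumann magnetic form `Q^(N)_{Φ,b,W}`. -/
def inMagDom {X : Type*} {E : X → Type*} [∀ x, NormedAddCommGroup (E x)]
    [∀ x, InnerProductSpace ℂ (E x)] (m : X → ℝ)
    (b : X → X → ℝ) (Φ : ∀ x y, E y ≃ₗᵢ[ℂ] E x) (W : ∀ x, E x →ₗ[ℂ] E x)
    (u : ∀ x, E x) : Prop :=
  MemL2Sec m u ∧ magEnergy b Φ W u < ⊤

/-- Membership in the domain of the Neumann scalar form `Q^(N)_{b,c}`. -/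
def inScalDom {X : Type*} (m : X → ℝ) (b : X → X → ℝ) (c : X → ℝ) (f : X → ℂ) : Prop :=
  (Summable fun x => ‖f x‖ ^ 2 * m x) ∧ scalEnergy b c f < ⊤

end

noncomputable section

/-- The section `v · sgn u`, given by `x ↦ v(x)u(x)/|u(x)|` when `u(x) ≠ 0` and `0` otherwise. -/
def sgnMul {X : Type*} {E : X → Type*} [∀ x, NormedAddCommGroup (E x)]
    [∀ x, InnerProductSpace ℂ (E x)] (v : X → ℝ) (u : ∀ x, E x) : ∀ x, E x :=
  fun x => if u x = 0 then 0 else ((v x / ‖u x‖ : ℝ) : ℂ) • u x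

end

/-- Scaling two vectors by factors in `[0,1]` does not increase the angular part of their
squared distance. -/
theorem norm_smul_sub_smul_sq_le {F : Type*} [NormedAddCommGroup F] [InnerProductSpace ℂ F]
    {p q : ℝ} (hp₀ : 0 ≤ p) (hp₁ : p ≤ 1) (hq₀ : 0 ≤ q) (hq₁ : q ≤ 1) (a b : F) :
    ‖(p : ℂ) • a - (q : ℂ) • b‖ ^ 2 ≤ (p * ‖a‖ - q * ‖b‖) ^ 2 + ‖a - b‖ ^ 2 := by
  have hre : RCLike.re ⟪a, b⟫ ≤ ‖a‖ * ‖b‖ := re_inner_le_norm a b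
  have hsmul : RCLike.re ⟪(p : ℂ) • a, (q : ℂ) • b⟫ = p * q * RCLike.re ⟪a, b⟫ := by
    rw [inner_smul_left, inner_smul_right]
    simp [mul_assoc]
  have hpq : p * q ≤ 1 := mul_le_one₀ hp₁ hq₀ hq₁
  rw [norm_sub_sq (𝕜 := ℂ), norm_sub_sq (𝕜 := ℂ), hsmul, norm_smul, norm_smul,
    Complex.norm_of_nonneg hp₀, Complex.norm_of_nonneg hq₀]
  nlinarith [mul_nonneg (sub_nonneg.2 hpq) (sub_nonneg.2 hre), sq_nonneg (‖a‖ - ‖b‖)]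

theorem div_norm_mul_norm {F : Type*} [NormedAddCommGroup F] {r : ℝ} {a : F} (h₀ : 0 ≤ r)
    (h₁ : r ≤ ‖a‖) : r / ‖a‖ * ‖a‖ = r :=
  div_mul_cancel_of_imp fun h => le_antisymm (h₁.trans h.le) h₀

section SgnMul

variable {X : Type*} {E : X → Type*} [∀ x, NormedAddCommGroup (E x)]
  [∀ x, InnerProductSpace ℂ (E x)]

theorem sgnMul_apply (v : X → ℝ) (u : ∀ x, E x) (x : X) :
    sgnMul v u x = ((v x / ‖u x‖ : ℝ) : ℂ) • u x := by
  by_cases h : u x = 0 <;> simp [sgnMul, h]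

theorem norm_sgnMul {v : X → ℝ} {u : ∀ x, E x} {x : X} (h₀ : 0 ≤ v x) (h₁ : v x ≤ ‖u x‖) :
    ‖sgnMul v u x‖ = v x := by
  rw [sgnMul_apply, norm_smul, Complex.norm_of_nonneg (by positivity), div_norm_mul_norm h₀ h₁]

theorem norm_sgnMul_sub_sq_le (Φ : ∀ x y, E y ≃ₗᵢ[ℂ] E x) {v : X → ℝ} {u : ∀ x, E x}
    (hvu : ∀ x, 0 ≤ v x ∧ v x ≤ ‖u x‖) (x y : X) :
    ‖sgnMul v u x - Φ x y (sgnMul v u y)‖ ^ 2 ≤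
      ‖(v x : ℂ) - (v y : ℂ)‖ ^ 2 + ‖u x - Φ x y (u y)‖ ^ 2 := by
  have h₀ (z : X) : 0 ≤ v z / ‖u z‖ := div_nonneg (hvu z).1 (norm_nonneg _)
  have h₁ (z : X) : v z / ‖u z‖ ≤ 1 := div_le_one_of_le₀ (hvu z).2 (norm_nonneg _)
  have h := norm_smul_sub_smul_sq_le (h₀ x) (h₁ x) (h₀ y) (h₁ y) (u x) (Φ x y (u y))
  rw [LinearIsometryEquiv.norm_map, div_norm_mul_norm (hvu x).1 (hvu x).2,
    div_norm_mul_norm (hvu y).1 (hvu y).2] at h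
  rw [sgnMul_apply, sgnMul_apply, map_smul, ← Complex.ofReal_sub, Complex.norm_real,
    Real.norm_eq_abs, sq_abs]
  exact h

theorem re_inner_sgnMul_le {W : ∀ x, E x →ₗ[ℂ] E x} {v : X → ℝ} {u : ∀ x, E x} {x : X}
    (hW : 0 ≤ (⟪W x (u x), u x⟫).re) (h₀ : 0 ≤ v x) (h₁ : v x ≤ ‖u x‖) :
    (⟪W x (sgnMul v u x), sgnMul v u x⟫).re ≤ (⟪W x (u x), u x⟫).re := by
  have hq₀ : 0 ≤ v x / ‖u x‖ := div_nonneg h₀ (norm_nonneg _)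
  have hq₁ : v x / ‖u x‖ ≤ 1 := div_le_one_of_le₀ h₁ (norm_nonneg _)
  rw [sgnMul_apply, map_smul, inner_smul_left, inner_smul_right, Complex.conj_ofReal,
    Complex.re_ofReal_mul, Complex.re_ofReal_mul, ← mul_assoc]
  exact mul_le_of_le_one_left hW (mul_le_one₀ hq₁ hq₀ hq₁)

theorem magEnergy_sgnMul_le {b : X → X → ℝ} (hb : ∀ x y, 0 ≤ b x y) (c : X → ℝ)
    (Φ : ∀ x y, E y ≃ₗᵢ[ℂ] E x) {W : ∀ x, E x →ₗ[ℂ] E x} {v : X → ℝ} {u : ∀ x, E x}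
    (hW : ∀ x, 0 ≤ (⟪W x (u x), u x⟫).re) (hvu : ∀ x, 0 ≤ v x ∧ v x ≤ ‖u x‖) :
    magEnergy b Φ W (sgnMul v u) ≤
      scalEnergy b c (fun x => (v x : ℂ)) + magEnergy b Φ W u := by
  unfold magEnergy scalEnergy
  rw [add_add_add_comm, ← mul_add, ← ENNReal.tsum_add]
  refine add_le_add (mul_le_mul_right (ENNReal.tsum_le_tsum fun p => ?_) _)
    (le_add_left (ENNReal.tsum_le_tsum fun x => ENNReal.ofReal_le_ofReal
      (re_inner_sgnMul_le (hW x) (hvu x).1 (hvu x).2)))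
  have hp := hb p.1 p.2
  rw [← ENNReal.ofReal_add (by positivity) (by positivity), ← mul_add]
  exact ENNReal.ofReal_le_ofReal
    (mul_le_mul_of_nonneg_left (norm_sgnMul_sub_sq_le Φ hvu p.1 p.2) hp)

end SgnMul

/-- For a weighted graph `(X,b,c,m)`, a Hermitian vector bundle with
unitary connection `Φ`, and `W` with `⟨W(x)v,v⟩ ≥ c(x)|v|²`: if `u` is in the domain of
`Q^(N)_{Φ,b,W}` and `v` is in the domain of `Q^(N)_{b,c}` with `0 ≤ v ≤ |u|` pointwise,
then `v·sgn u` lies in the domain of `Q^(N)_{Φ,b,W}` and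
`Q̃_{Φ,b,W}(v·sgn u) ≤ Q^(N)_{b,c}(v) + Q^(N)_{Φ,b,W}(u)`. -/
theorem stmt8 {X : Type*} [Countable X]
    (b : X → X → ℝ) (hb0 : ∀ x y, 0 ≤ b x y) (hbdiag : ∀ x, b x x = 0)
    (hbsymm : ∀ x y, b x y = b y x) (hbsum : ∀ x, Summable fun y => b x y)
    (c : X → ℝ) (hc : ∀ x, 0 ≤ c x) (m : X → ℝ) (hm : ∀ x, 0 < m x)
    (E : X → Type*) [∀ x, NormedAddCommGroup (E x)] [∀ x, InnerProductSpace ℂ (E x)]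
    [∀ x, FiniteDimensional ℂ (E x)]
    (Φ : ∀ x y, E y ≃ₗᵢ[ℂ] E x) (hΦ : ∀ x y, Φ x y = (Φ y x).symm)
    (W : ∀ x, E x →ₗ[ℂ] E x) (hW : ∀ x (w : E x), c x * ‖w‖ ^ 2 ≤ (⟪W x w, w⟫).re)
    (u : ∀ x, E x) (hu : inMagDom m b Φ W u)
    (v : X → ℝ) (hv : inScalDom m b c fun x => (v x : ℂ))
    (hvu : ∀ x, 0 ≤ v x ∧ v x ≤ ‖u x‖) :
    inMagDom m b Φ W (sgnMul v u) ∧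
      magEnergy b Φ W (sgnMul v u) ≤
        scalEnergy b c (fun x => (v x : ℂ)) + magEnergy b Φ W u := by
  have hle := magEnergy_sgnMul_le hb0 c Φ (W := W)
    (fun x => (mul_nonneg (hc x) (sq_nonneg _)).trans (hW x (u x))) hvu
  refine ⟨⟨hv.1.congr fun x => ?_, hle.trans_lt (ENNReal.add_lt_top.2 ⟨hv.2, hu.2⟩)⟩, hle⟩
  rw [norm_sgnMul (hvu x).1 (hvu x).2, Complex.norm_of_nonneg (hvu x).1]
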